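/- Let N ≥ 1, 1 ≤ k ≤ N, and let A ∈ M_N(ℂ) be such that its Hermitian part Re A = (A + A*)/2 is positive definite. Let U_k be an N×k matrix with orthonormal columns (U_k* U_k = 1_k). Then A is invertible, U_k* A⁻¹ U_k is invertible, and ‖A⁻¹ U_k (U_k* A⁻¹ U_k)⁻¹ U_k* A⁻¹‖ ≤ ‖(Re A)⁻¹‖, where ‖·‖ is the operator norm. The same bound holds with Im A = (A − A*)/(2i) in place of Re A whenever Im A is positive definite. -/

import Mathlib

open Matrix
open scoped ComplexOrder

/-- The operator (ℓ²→ℓ²) norm of a square complex matrix. -/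
noncomputable def opNorm {n : ℕ} (A : Matrix (Fin n) (Fin n) ℂ) : ℝ :=
  ‖(Matrix.toEuclideanCLM (𝕜 := ℂ) A : EuclideanSpace ℂ (Fin n) →L[ℂ] EuclideanSpace ℂ (Fin n))‖

/-- The Hermitian part `Re A = (A + Aᴴ)/2`. -/
noncomputable def reMat {n : ℕ} (A : Matrix (Fin n) (Fin n) ℂ) : Matrix (Fin n) (Fin n) ℂ :=
  (2⁻¹ : ℂ) • (A + Aᴴ)

/-- The anti-Hermitian part `Im A = (A − Aᴴ)/(2i)`. -/
noncomputable def imMat {n : ℕ} (A : Matrix (Fin n) (Fin n) ℂ) : Matrix (Fin n) (Fin n) ℂ :=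
  ((2 * Complex.I)⁻¹ : ℂ) • (A - Aᴴ)

open scoped InnerProductSpace in
/-- If `H` is a positive operator with right inverse `G`, then the points `a` with
`re ⟪a, H a⟫ = re ⟪a, y⟫` are pairwise at distance at most `‖G‖ * ‖y‖`. -/
theorem norm_sub_le_of_re_inner_eq {E : Type*} [NormedAddCommGroup E] [InnerProductSpace ℂ E]
    {H G : E →L[ℂ] E} (hH : H.IsPositive) (hHG : ∀ v, H (G v) = v) {a x y : E}
    (ha : (⟪a, H a⟫_ℂ).re = (⟪a, y⟫_ℂ).re) (hx : (⟪x, H x⟫_ℂ).re = (⟪x, y⟫_ℂ).re) :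
    ‖a - x‖ ≤ ‖G‖ * ‖y‖ := by
  have symm (u v : E) : (⟪u, H v⟫_ℂ).re = (⟪v, H u⟫_ℂ).re := by
    rw [← show ⟪H u, v⟫_ℂ = ⟪u, H v⟫_ℂ from hH.isSymmetric u v]
    exact inner_re_symm (𝕜 := ℂ) (H u) v
  have nonneg (u : E) : 0 ≤ (⟪u, H u⟫_ℂ).re := hH.re_inner_nonneg_right u
  have smul (r : ℝ) (u v : E) : (⟪(r : ℂ) • u, v⟫_ℂ).re = r * (⟪u, v⟫_ℂ).re := by simp
  have smul' (r : ℝ) (u v : E) : (⟪u, (r : ℂ) • v⟫_ℂ).re = r * (⟪u, v⟫_ℂ).re := by simp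
  have bound (v : E) : (⟪v, G v⟫_ℂ).re ≤ ‖G‖ * ‖v‖ ^ 2 :=
    calc (⟪v, G v⟫_ℂ).re ≤ ‖v‖ * ‖G v‖ := re_inner_le_norm (𝕜 := ℂ) v (G v)
      _ ≤ ‖v‖ * (‖G‖ * ‖v‖) := by gcongr; exact G.le_opNorm v
      _ = ‖G‖ * ‖v‖ ^ 2 := by ring
  have re_symm (u v : E) : (⟪u, v⟫_ℂ).re = (⟪v, u⟫_ℂ).re := inner_re_symm (𝕜 := ℂ) u v
  set m := a - x with hm
  set c := ‖G‖ with hc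
  have energy : (⟪m, H m⟫_ℂ).re ≤ c * ‖y‖ ^ 2 := by
    have h := nonneg (a + x - G y)
    have hy := bound y
    have h1 := symm a x
    have h2 := symm (G y) a
    have h3 := symm (G y) x
    simp only [hm, map_sub, map_add, hHG, inner_sub_left, inner_sub_right, inner_add_left,
      inner_add_right, Complex.sub_re, Complex.add_re] at h h2 h3 ⊢
    have h4 := re_symm (G y) y
    linarith
  have coercive : c * ‖m‖ ^ 2 ≤ c ^ 2 * (⟪m, H m⟫_ℂ).re := by
    have h := nonneg ((c : ℂ) • m - G m)
    have hb := bound m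
    have h1 := symm (G m) m
    have h2 := re_symm (G m) m
    have h3 : (⟪m, m⟫_ℂ).re = ‖m‖ ^ 2 := inner_self_eq_norm_sq (𝕜 := ℂ) m
    simp only [map_sub, map_smul, hHG, inner_sub_left, inner_sub_right, Complex.sub_re,
      smul, smul'] at h h1
    rw [h1, h2, h3] at h
    linarith
  rcases (norm_nonneg G).eq_or_lt with h0 | h0
  · have hG : G = 0 := norm_eq_zero.mp h0.symm
    have : m = 0 := by rw [← hHG m, hG]; simp
    rw [this, norm_zero]
    positivity
  · refine le_of_sq_le_sq ?_ (by positivity)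
    have h := mul_le_mul_of_nonneg_left energy (sq_nonneg c)
    have h' : c * ‖m‖ ^ 2 ≤ c * (c * ‖y‖) ^ 2 := by linarith
    exact le_of_mul_le_mul_left h' h0

theorem re_star_dotProduct_reMat_mulVec {n : ℕ} (A : Matrix (Fin n) (Fin n) ℂ) (v : Fin n → ℂ) :
    (star v ⬝ᵥ reMat A *ᵥ v).re = (star v ⬝ᵥ A *ᵥ v).re := by
  have h : star v ⬝ᵥ Aᴴ *ᵥ v = star (star v ⬝ᵥ A *ᵥ v) := by
    rw [star_dotProduct, star_mulVec, dotProduct_mulVec, dotProduct_comm]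
    simp [dotProduct_comm]
  rw [reMat, smul_mulVec, add_mulVec, dotProduct_smul, dotProduct_add, h]
  simp
  ring

theorem eq_zero_of_re_star_dotProduct_mulVec_eq_zero {n : ℕ} {A : Matrix (Fin n) (Fin n) ℂ}
    (hA : (reMat A).PosDef) {v : Fin n → ℂ} (hv : (star v ⬝ᵥ A *ᵥ v).re = 0) : v = 0 := by
  by_contra h
  have := hA.re_dotProduct_pos h
  rw [← re_star_dotProduct_reMat_mulVec] at hv
  exact this.ne' hv

theorem isUnit_of_posDef_reMat {n : ℕ} {A : Matrix (Fin n) (Fin n) ℂ}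
    (hA : (reMat A).PosDef) : IsUnit A := by
  rw [← mulVec_injective_iff_isUnit]
  refine (injective_iff_map_eq_zero A.mulVecLin).mpr fun v hv => ?_
  rw [mulVecLin_apply] at hv
  exact eq_zero_of_re_star_dotProduct_mulVec_eq_zero hA (by simp [hv])

theorem isUnit_conjTranspose_mul_inv_mul {n k : ℕ} {A : Matrix (Fin n) (Fin n) ℂ}
    (hA : (reMat A).PosDef) {U : Matrix (Fin n) (Fin k) ℂ} (hU : Uᴴ * U = 1) :
    IsUnit (Uᴴ * A⁻¹ * U) := by
  have hdet : IsUnit A.det := A.isUnit_iff_isUnit_det.mp (isUnit_of_posDef_reMat hA)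
  rw [← mulVec_injective_iff_isUnit]
  refine (injective_iff_map_eq_zero (Uᴴ * A⁻¹ * U).mulVecLin).mpr fun v hv => ?_
  rw [mulVecLin_apply] at hv
  have hAw : A *ᵥ (A⁻¹ *ᵥ (U *ᵥ v)) = U *ᵥ v := by
    rw [mulVec_mulVec, mul_nonsing_inv A hdet, one_mulVec]
  have hw : A⁻¹ *ᵥ (U *ᵥ v) = 0 := by
    refine eq_zero_of_re_star_dotProduct_mulVec_eq_zero hA ?_
    have h : Uᴴ *ᵥ (A⁻¹ *ᵥ (U *ᵥ v)) = 0 := by simpa only [mulVec_mulVec, Matrix.mul_assoc] using hv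
    have h' : star (A⁻¹ *ᵥ (U *ᵥ v)) ᵥ* U = 0 := by
      rw [← star_eq_zero, star_vecMul, star_star, h]
    rw [hAw, dotProduct_mulVec, h', zero_dotProduct, Complex.zero_re]
  rw [hw, mulVec_zero] at hAw
  rw [← one_mulVec v, ← hU, ← mulVec_mulVec, ← hAw, mulVec_zero]

open scoped InnerProductSpace in
theorem opNorm_sub_le_opNorm_inv_reMat {n : ℕ} {A R S : Matrix (Fin n) (Fin n) ℂ}
    (hA : (reMat A).PosDef) (hR : Rᴴ * A * R = Rᴴ) (hS : Sᴴ * A * S = Sᴴ) :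
    opNorm (R - S) ≤ opNorm (reMat A)⁻¹ := by
  have hdet : IsUnit (reMat A).det := (reMat A).isUnit_iff_isUnit_det.mp hA.isUnit
  have key {S : Matrix (Fin n) (Fin n) ℂ} (hS : Sᴴ * A * S = Sᴴ) (y : EuclideanSpace ℂ (Fin n)) :
      (⟪toEuclideanCLM (𝕜 := ℂ) S y,
        toEuclideanCLM (𝕜 := ℂ) (reMat A) (toEuclideanCLM (𝕜 := ℂ) S y)⟫_ℂ).re =
      (⟪toEuclideanCLM (𝕜 := ℂ) S y, y⟫_ℂ).re := by
    simp only [EuclideanSpace.inner_eq_star_dotProduct, ofLp_toEuclideanCLM]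
    rw [dotProduct_comm, re_star_dotProduct_reMat_mulVec, dotProduct_comm y.ofLp, star_mulVec]
    rw [mulVec_mulVec, dotProduct_mulVec, vecMul_vecMul, ← Matrix.mul_assoc, hS]
  refine ContinuousLinearMap.opNorm_le_bound _ (norm_nonneg _) fun y => ?_
  rw [map_sub, _root_.sub_apply]
  refine norm_sub_le_of_re_inner_eq (H := toEuclideanCLM (𝕜 := ℂ) (reMat A)) ?_ (fun v => ?_)
    (key hR y) (key hS y)
  · rw [← ContinuousLinearMap.isPositive_toLinearMap_iff, coe_toEuclideanCLM_eq_toEuclideanLin,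
      isPositive_toEuclideanLin_iff]
    exact hA.posSemidef
  · rw [← mul_apply_eq_comp, ← map_mul, mul_nonsing_inv _ hdet, map_one,
      one_apply_eq_self]

theorem opNorm_le_opNorm_inv_reMat {n k : ℕ} {A : Matrix (Fin n) (Fin n) ℂ}
    (hA : (reMat A).PosDef) {U : Matrix (Fin n) (Fin k) ℂ} (hU : Uᴴ * U = 1) :
    opNorm (A⁻¹ * U * (Uᴴ * A⁻¹ * U)⁻¹ * Uᴴ * A⁻¹) ≤ opNorm (reMat A)⁻¹ := by
  have hdet : IsUnit A.det := A.isUnit_iff_isUnit_det.mp (isUnit_of_posDef_reMat hA)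
  have hdet' : IsUnit (Uᴴ * A⁻¹ * U).det :=
    (isUnit_iff_isUnit_det _).mp (isUnit_conjTranspose_mul_inv_mul hA hU)
  set M := A⁻¹ * U * (Uᴴ * A⁻¹ * U)⁻¹ * Uᴴ * A⁻¹ with hM
  have hUS : Uᴴ * (A⁻¹ - M) = 0 := by
    have : Uᴴ * M = (Uᴴ * A⁻¹ * U) * (Uᴴ * A⁻¹ * U)⁻¹ * (Uᴴ * A⁻¹) := by
      simp only [hM, Matrix.mul_assoc]
    rw [Matrix.mul_sub, this, mul_nonsing_inv _ hdet', Matrix.one_mul, sub_self]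
  have hSU : (A⁻¹ - M)ᴴ * U = 0 := by
    rw [← conjTranspose_eq_zero, conjTranspose_mul, conjTranspose_conjTranspose, hUS]
  have hAM : A * M = U * ((Uᴴ * A⁻¹ * U)⁻¹ * Uᴴ * A⁻¹) := by
    have : A * M = (A * A⁻¹) * (U * ((Uᴴ * A⁻¹ * U)⁻¹ * Uᴴ * A⁻¹)) := by
      simp only [hM, Matrix.mul_assoc]
    rw [this, mul_nonsing_inv _ hdet, Matrix.one_mul]
  have hR : (A⁻¹)ᴴ * A * A⁻¹ = (A⁻¹)ᴴ := by
    rw [Matrix.mul_assoc, mul_nonsing_inv _ hdet, mul_one]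
  have hS : (A⁻¹ - M)ᴴ * A * (A⁻¹ - M) = (A⁻¹ - M)ᴴ := by
    rw [Matrix.mul_assoc, mul_sub A, mul_nonsing_inv _ hdet, hAM, mul_sub, mul_one, ← Matrix.mul_assoc, hSU,
      Matrix.zero_mul, sub_zero]
  simpa using opNorm_sub_le_opNorm_inv_reMat hA hR hS

theorem imMat_eq_reMat {n : ℕ} (A : Matrix (Fin n) (Fin n) ℂ) :
    imMat A = reMat ((-Complex.I) • A) := by
  rw [imMat, reMat, conjTranspose_smul, mul_inv, Complex.inv_I]
  simp [smul_smul, sub_eq_add_neg]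

theorem opNorm_smul {n : ℕ} (c : ℂ) (A : Matrix (Fin n) (Fin n) ℂ) :
    opNorm (c • A) = ‖c‖ * opNorm A := by
  rw [opNorm, map_smul, norm_smul, opNorm]

/-- If the Hermitian part of `A` is positive definite and `U_k` has
orthonormal columns, then `A` and `U_kᴴ A⁻¹ U_k` are invertible and
`‖A⁻¹ U_k (U_kᴴ A⁻¹ U_k)⁻¹ U_kᴴ A⁻¹‖ ≤ ‖(Re A)⁻¹‖`; likewise with `Im A` in place
of `Re A` whenever `Im A` is positive definite. -/
theorem stmt1 (N k : ℕ) (hN : 1 ≤ N) (hk : 1 ≤ k) (hkN : k ≤ N)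
    (A : Matrix (Fin N) (Fin N) ℂ)
    (Uk : Matrix (Fin N) (Fin k) ℂ) (hUk : Ukᴴ * Uk = 1) :
    ((reMat A).PosDef →
      IsUnit A ∧ IsUnit (Ukᴴ * A⁻¹ * Uk) ∧
        opNorm (A⁻¹ * Uk * (Ukᴴ * A⁻¹ * Uk)⁻¹ * Ukᴴ * A⁻¹) ≤ opNorm ((reMat A)⁻¹)) ∧
    ((imMat A).PosDef →
      IsUnit A ∧ IsUnit (Ukᴴ * A⁻¹ * Uk) ∧
        opNorm (A⁻¹ * Uk * (Ukᴴ * A⁻¹ * Uk)⁻¹ * Ukᴴ * A⁻¹) ≤ opNorm ((imMat A)⁻¹)) := by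
  refine ⟨fun hA => ⟨isUnit_of_posDef_reMat hA, isUnit_conjTranspose_mul_inv_mul hA hUk,
    opNorm_le_opNorm_inv_reMat hA hUk⟩, fun hA => ?_⟩
  rw [imMat_eq_reMat] at hA ⊢
  have hu : IsUnit A := by
    have h := (isUnit_of_posDef_reMat hA).smul (Units.mk0 Complex.I Complex.I_ne_zero)
    simpa [Units.smul_def, smul_smul] using h
  have hinv : ((-Complex.I) • A)⁻¹ = Complex.I • A⁻¹ := by
    refine inv_eq_left_inv ?_
    simp [smul_smul, nonsing_inv_mul _ (A.isUnit_iff_isUnit_det.mp hu)]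
  have hB := isUnit_conjTranspose_mul_inv_mul hA hUk
  have hle := opNorm_le_opNorm_inv_reMat hA hUk
  have hsmul : Ukᴴ * (Complex.I • A⁻¹) * Uk = Complex.I • (Ukᴴ * A⁻¹ * Uk) := by simp
  rw [hinv, hsmul] at hB hle
  have hu' : IsUnit (Ukᴴ * A⁻¹ * Uk) := by
    have h := hB.smul (Units.mk0 (-Complex.I) (neg_ne_zero.mpr Complex.I_ne_zero))
    simpa [Units.smul_def, smul_smul] using h
  have hinv' : (Complex.I • (Ukᴴ * A⁻¹ * Uk))⁻¹ = (-Complex.I) • (Ukᴴ * A⁻¹ * Uk)⁻¹ := by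
    refine inv_eq_left_inv ?_
    rw [smul_mul_smul_comm, nonsing_inv_mul _ ((isUnit_iff_isUnit_det _).mp hu')]
    simp
  refine ⟨hu, hu', le_trans (le_of_eq ?_) hle⟩
  have hM : Complex.I • A⁻¹ * Uk * (Complex.I • (Ukᴴ * A⁻¹ * Uk))⁻¹ * Ukᴴ * Complex.I • A⁻¹ =
      Complex.I • (A⁻¹ * Uk * (Ukᴴ * A⁻¹ * Uk)⁻¹ * Ukᴴ * A⁻¹) := by
    rw [hinv']
    simp [smul_smul]
  rw [hM, opNorm_smul, Complex.norm_I, one_mul]
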